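/- Let Y be a Banach space and let ω be a non-decreasing modulus that is doubling (ω(2t) ≤ C_db·ω(t) for all t > 0, with C_db > 1), satisfies the Dini-type condition [ω]_* := sup_{s>0} (1/ω(s)) ∫_0^s ω(t)/t dt < ∞, and satisfies ω(t) → ∞ as t → ∞. Then for every continuous locally Bochner integrable f : ℝ^n → Y and for each scale Γ ∈ {small, far, large}: f ∈ VC^{0,ω}_Γ(ℝ^n,Y) if and only if f ∈ VMO^ω_Γ(ℝ^n,Y); consequently f ∈ VC^{0,ω}(ℝ^n,Y) if and only if f ∈ VMO^ω(ℝ^n,Y). -/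

import Mathlib

open Filter Set

/-- An admissible modulus of continuity `ω : (0,∞) → (0,∞)`: positive, non-decreasing,
`ω(t) → 0` as `t → 0⁺`, `ω(t) → ∞` as `t → ∞`, `t/ω(t) → 0` as `t → 0⁺`, and doubling. -/
def Admissible (ω : ℝ → ℝ) : Prop :=
  (∀ t : ℝ, 0 < t → 0 < ω t) ∧
  (∀ s t : ℝ, 0 < s → s ≤ t → ω s ≤ ω t) ∧
  Tendsto ω (nhdsWithin 0 (Ioi 0)) (nhds 0) ∧
  Tendsto ω atTop atTop ∧
  Tendsto (fun t => t / ω t) (nhdsWithin 0 (Ioi 0)) (nhds 0) ∧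
  ∃ C : ℝ, 1 < C ∧ ∀ t : ℝ, 0 < t → ω (2 * t) ≤ C * ω t

section Defs

variable {X Y : Type*} [NormedAddCommGroup X] [NormedSpace ℝ X]
  [NormedAddCommGroup Y] [NormedSpace ℝ Y]

/-- `‖f‖_{Ċ^{0,ω}} ≤ M`. -/
def HolderLE (ω : ℝ → ℝ) (f : X → Y) (M : ℝ) : Prop :=
  ∀ x y : X, x ≠ y → ‖f x - f y‖ ≤ M * ω ‖x - y‖

/-- `f ∈ Ċ^{0,ω}(X,Y)`: the homogeneous Hölder seminorm is finite. -/
def HolderFinite (ω : ℝ → ℝ) (f : X → Y) : Prop :=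
  ∃ M : ℝ, HolderLE ω f M

/-- `f ∈ VC^{0,ω}_small(X,Y)`. -/
def VCsmall (ω : ℝ → ℝ) (f : X → Y) : Prop :=
  HolderFinite ω f ∧
    ∀ ε : ℝ, 0 < ε → ∃ δ : ℝ, 0 < δ ∧ ∀ x y : X, x ≠ y → ‖x - y‖ < δ →
      ‖f x - f y‖ ≤ ε * ω ‖x - y‖

/-- `f ∈ VC^{0,ω}_large(X,Y)`. -/
def VClarge (ω : ℝ → ℝ) (f : X → Y) : Prop :=
  HolderFinite ω f ∧
    ∀ ε : ℝ, 0 < ε → ∃ δ : ℝ, 0 < δ ∧ ∀ x y : X, δ < ‖x - y‖ →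
      ‖f x - f y‖ ≤ ε * ω ‖x - y‖

/-- `f ∈ VC^{0,ω}_far(X,Y)`. -/
def VCfar (ω : ℝ → ℝ) (f : X → Y) : Prop :=
  HolderFinite ω f ∧
    ∀ ε : ℝ, 0 < ε → ∃ δ : ℝ, 0 < δ ∧ ∀ x y : X, x ≠ y → δ < ‖x‖ → δ < ‖y‖ →
      ‖f x - f y‖ ≤ ε * ω ‖x - y‖

/-- `f ∈ VC^{0,ω}(X,Y)`, the intersection of the three vanishing classes. -/
def VCfull (ω : ℝ → ℝ) (f : X → Y) : Prop :=
  VCsmall ω f ∧ VClarge ω f ∧ VCfar ω f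

/-- `f` has bounded support: it vanishes outside some bounded set. -/
def BddSupp (f : X → Y) : Prop :=
  ∃ R : ℝ, ∀ x : X, R < ‖x‖ → f x = 0

end Defs

section BMO

open MeasureTheory

variable {n : ℕ} {Y : Type*} [NormedAddCommGroup Y] [NormedSpace ℝ Y]

/-- The closed axis-parallel cube in `ℝⁿ` with lower corner `c` and side length `ℓ`. -/
def cube (c : EuclideanSpace ℝ (Fin n)) (ℓ : ℝ) : Set (EuclideanSpace ℝ (Fin n)) :=
  {y | ∀ i : Fin n, c i ≤ y i ∧ y i ≤ c i + ℓ}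

/-- The mean oscillation functional
`𝒪^ω(f;Q) = (1/ω(ℓ(Q))) ⨍_Q ‖f − ⟨f⟩_Q‖` over the cube `Q = cube c ℓ`. -/
noncomputable def osc (ω : ℝ → ℝ) (f : EuclideanSpace ℝ (Fin n) → Y)
    (c : EuclideanSpace ℝ (Fin n)) (ℓ : ℝ) : ℝ :=
  (1 / ω ℓ) * ⨍ y in cube c ℓ, ‖f y - ⨍ z in cube c ℓ, f z‖

/-- `‖f‖_{BMO^ω} ≤ M`: all mean oscillations are bounded by `M`. -/
def BMOLE (ω : ℝ → ℝ) (f : EuclideanSpace ℝ (Fin n) → Y) (M : ℝ) : Prop :=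
  ∀ (c : EuclideanSpace ℝ (Fin n)) (ℓ : ℝ), 0 < ℓ → osc ω f c ℓ ≤ M

end BMO

section VMO

open MeasureTheory

variable {n : ℕ} {Y : Type*} [NormedAddCommGroup Y] [NormedSpace ℝ Y]

/-- `f ∈ VMO^ω_small(ℝⁿ,Y)`. -/
def VMOsmall (ω : ℝ → ℝ) (f : EuclideanSpace ℝ (Fin n) → Y) : Prop :=
  (∃ M : ℝ, BMOLE ω f M) ∧
    ∀ ε : ℝ, 0 < ε → ∃ δ : ℝ, 0 < δ ∧
      ∀ (c : EuclideanSpace ℝ (Fin n)) (ℓ : ℝ), 0 < ℓ → ℓ < δ → osc ω f c ℓ ≤ ε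

/-- `f ∈ VMO^ω_large(ℝⁿ,Y)`. -/
def VMOlarge (ω : ℝ → ℝ) (f : EuclideanSpace ℝ (Fin n) → Y) : Prop :=
  (∃ M : ℝ, BMOLE ω f M) ∧
    ∀ ε : ℝ, 0 < ε → ∃ δ : ℝ, 0 < δ ∧
      ∀ (c : EuclideanSpace ℝ (Fin n)) (ℓ : ℝ), 0 < ℓ → δ < ℓ → osc ω f c ℓ ≤ ε

/-- `f ∈ VMO^ω_far(ℝⁿ,Y)`. -/
def VMOfar (ω : ℝ → ℝ) (f : EuclideanSpace ℝ (Fin n) → Y) : Prop :=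
  (∃ M : ℝ, BMOLE ω f M) ∧
    ∀ ε : ℝ, 0 < ε → ∃ δ : ℝ, 0 < δ ∧
      ∀ (c : EuclideanSpace ℝ (Fin n)) (ℓ : ℝ), 0 < ℓ →
        δ < Metric.infDist (0 : EuclideanSpace ℝ (Fin n)) (cube c ℓ) → osc ω f c ℓ ≤ ε

/-- `f ∈ VMO^ω(ℝⁿ,Y)`, the intersection of the three vanishing classes. -/
def VMOfull (ω : ℝ → ℝ) (f : EuclideanSpace ℝ (Fin n) → Y) : Prop :=
  VMOsmall ω f ∧ VMOlarge ω f ∧ VMOfar ω f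

end VMO

section CubeAverages

open MeasureTheory

variable {n : ℕ} {Y : Type*} [NormedAddCommGroup Y]

theorem cube_eq_preimage_Icc (c : EuclideanSpace ℝ (Fin n)) (ℓ : ℝ) :
    cube c ℓ = WithLp.ofLp ⁻¹' Set.Icc c.ofLp (fun i => c i + ℓ) := by
  ext y
  simp only [cube, Set.mem_ofPred_eq, Set.mem_preimage, Set.mem_Icc, Pi.le_def]
  exact forall_and

theorem isCompact_cube (c : EuclideanSpace ℝ (Fin n)) (ℓ : ℝ) : IsCompact (cube c ℓ) := by
  rw [cube_eq_preimage_Icc]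
  exact (PiLp.homeomorph 2 (fun _ : Fin n => ℝ)).isCompact_preimage.2 isCompact_Icc

theorem volume_real_cube (c : EuclideanSpace ℝ (Fin n)) {ℓ : ℝ} (hℓ : 0 ≤ ℓ) :
    volume.real (cube c ℓ) = ℓ ^ n := by
  rw [cube_eq_preimage_Icc, measureReal_def,
    (PiLp.volume_preserving_ofLp (Fin n)).measure_preimage measurableSet_Icc.nullMeasurableSet,
    Real.volume_Icc_pi]
  simp [ENNReal.toReal_ofReal hℓ]

theorem EuclideanSpace.norm_le_card_mul {x : EuclideanSpace ℝ (Fin n)} {K : ℝ} (hK : 0 ≤ K)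
    (h : ∀ i, |x i| ≤ K) : ‖x‖ ≤ n * K := by
  rw [EuclideanSpace.norm_eq]
  apply Real.sqrt_le_iff.2 ⟨by positivity, ?_⟩
  have h' : ∀ i ∈ (Finset.univ : Finset (Fin n)), ‖x i‖ ^ 2 ≤ K ^ 2 := by
    intro i _
    rw [Real.norm_eq_abs]
    gcongr
    exact h i
  refine (Finset.sum_le_sum h').trans ?_
  have : (n : ℝ) ≤ (n : ℝ) ^ 2 := by exact_mod_cast Nat.le_self_pow two_ne_zero n
  simp only [Finset.sum_const, Finset.card_univ, Fintype.card_fin, nsmul_eq_mul, mul_pow]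
  gcongr

theorem norm_sub_le_of_mem_cube {c x y : EuclideanSpace ℝ (Fin n)} {ℓ : ℝ} (hℓ : 0 ≤ ℓ)
    (hx : x ∈ cube c ℓ) (hy : y ∈ cube c ℓ) : ‖x - y‖ ≤ n * ℓ := by
  refine EuclideanSpace.norm_le_card_mul hℓ fun i => ?_
  have := hx i
  have := hy i
  rw [PiLp.sub_apply, abs_le]
  constructor <;> linarith

theorem exists_cube_mem_mem (x y : EuclideanSpace ℝ (Fin n)) :
    ∃ c, x ∈ cube c ‖x - y‖ ∧ y ∈ cube c ‖x - y‖ := by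
  refine ⟨WithLp.toLp 2 fun i => min (x i) (y i), fun i => ?_, fun i => ?_⟩
  all_goals
    have h := (PiLp.norm_apply_le (x - y) i).trans_eq' (by rw [PiLp.sub_apply, Real.norm_eq_abs])
    rw [abs_le] at h
    refine ⟨by simp, ?_⟩
    rcases min_cases (x i) (y i) with ⟨h1, -⟩ | ⟨h1, -⟩ <;> simp only [h1] <;> linarith

/-- A point far from the origin shares a cube, itself away from the origin, with a point of
controlled norm. -/
theorem exists_cube_away_from_zero [Nonempty (Fin n)] {a : ℝ} (ha : 0 ≤ a)
    {x : EuclideanSpace ℝ (Fin n)} (hx : n * a < ‖x‖) :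
    ∃ c p, x ∈ cube c ‖x‖ ∧ p ∈ cube c ‖x‖ ∧ ‖p‖ ≤ n * a ∧ ∀ z ∈ cube c ‖x‖, a ≤ ‖z‖ := by
  obtain ⟨j, hj⟩ : ∃ j, a < |x j| := by
    by_contra! h
    exact hx.not_ge (EuclideanSpace.norm_le_card_mul ha h)
  set L := ‖x‖ with hL
  have hL0 : 0 ≤ L := norm_nonneg x
  have hxL : ∀ i, |x i| ≤ L := fun i => PiLp.norm_apply_le x i
  refine ⟨WithLp.toLp 2 fun i =>
      if 0 ≤ x i then (if i = j then a else 0) else -(if i = j then a else 0) - L,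
    WithLp.toLp 2 fun i => if 0 ≤ x i then (if i = j then a else 0) else -(if i = j then a else 0),
    fun i => ?_, fun i => ?_, EuclideanSpace.norm_le_card_mul ha fun i => ?_, fun z hz => ?_⟩
  · have := hxL i
    rcases eq_or_ne i j with rfl | hij
    · simp only [if_true]
      split_ifs with h
      · rw [abs_of_nonneg h] at *
        constructor <;> linarith
      · rw [abs_of_neg (not_le.1 h)] at *
        constructor <;> linarith
    · simp only [hij, if_false]
      split_ifs with h
      · rw [abs_of_nonneg h] at *
        constructor <;> linarith
      · rw [abs_of_neg (not_le.1 h)] at *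
        constructor <;> linarith
  · simp only
    split_ifs <;> constructor <;> linarith
  · simp only
    split_ifs <;> simp [abs_of_nonneg ha, ha]
  · refine le_trans ?_ (PiLp.norm_apply_le z j)
    have := hz j
    simp only [if_true] at this
    rw [Real.norm_eq_abs, le_abs]
    split_ifs at this with h
    · left; linarith
    · right; linarith

theorem mem_cube_self (c : EuclideanSpace ℝ (Fin n)) {ℓ : ℝ} (hℓ : 0 ≤ ℓ) : c ∈ cube c ℓ :=
  fun i => ⟨le_rfl, by linarith⟩

theorem integrableOn_cube {f : EuclideanSpace ℝ (Fin n) → Y} (hf : Continuous f)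
    (c : EuclideanSpace ℝ (Fin n)) (ℓ : ℝ) : IntegrableOn f (cube c ℓ) :=
  hf.continuousOn.integrableOn_compact (isCompact_cube c ℓ)

theorem setAverage_norm_nonneg (g : EuclideanSpace ℝ (Fin n) → Y)
    (s : Set (EuclideanSpace ℝ (Fin n))) : 0 ≤ ⨍ y in s, ‖g y‖ := by
  rw [setAverage_eq, smul_eq_mul]
  positivity

theorem setAverage_cube_norm_le {f : EuclideanSpace ℝ (Fin n) → Y}
    (c : EuclideanSpace ℝ (Fin n)) {ℓ K : ℝ} (hℓ : 0 < ℓ) (h : ∀ x ∈ cube c ℓ, ‖f x‖ ≤ K) :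
    (⨍ z in cube c ℓ, ‖f z‖) ≤ K := by
  have hv : 0 < volume.real (cube c ℓ) := by
    rw [volume_real_cube c hℓ.le]
    positivity
  have := norm_setIntegral_le_of_norm_le_const (μ := volume) (f := fun z => ‖f z‖)
    (isCompact_cube c ℓ).measure_lt_top (fun x hx => by simpa using h x hx)
  rw [setAverage_eq, smul_eq_mul, inv_mul_le_iff₀ hv, mul_comm]
  exact (le_abs_self _).trans this

variable [NormedSpace ℝ Y]

theorem setAverage_cube_sub [CompleteSpace Y] {f : EuclideanSpace ℝ (Fin n) → Y}
    (hf : Continuous f) (c : EuclideanSpace ℝ (Fin n)) {ℓ : ℝ} (hℓ : 0 < ℓ) (a : Y) :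
    (⨍ z in cube c ℓ, f z) - a = ⨍ z in cube c ℓ, (f z - a) := by
  have hv : volume.real (cube c ℓ) ≠ 0 := by
    rw [volume_real_cube c hℓ.le]
    positivity
  have hfin : IntegrableOn (fun _ => a) (cube c ℓ) := integrableOn_cube continuous_const c ℓ
  rw [setAverage_eq, setAverage_eq, integral_sub (integrableOn_cube hf c ℓ) hfin,
    setIntegral_const, smul_sub, smul_smul, inv_mul_cancel₀ hv, one_smul]

theorem norm_setAverage_le (f : EuclideanSpace ℝ (Fin n) → Y)
    (s : Set (EuclideanSpace ℝ (Fin n))) : ‖⨍ z in s, f z‖ ≤ ⨍ z in s, ‖f z‖ := by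
  rw [setAverage_eq, setAverage_eq, norm_smul, smul_eq_mul, norm_inv, Real.norm_eq_abs,
    abs_of_nonneg measureReal_nonneg]
  gcongr
  exact norm_integral_le_integral_norm _

theorem norm_sub_setAverage_cube_le [CompleteSpace Y] {f : EuclideanSpace ℝ (Fin n) → Y}
    (hf : Continuous f) (c : EuclideanSpace ℝ (Fin n)) {ℓ K : ℝ} (hℓ : 0 < ℓ) (a : Y)
    (h : ∀ x ∈ cube c ℓ, ‖f x - a‖ ≤ K) : ‖a - ⨍ z in cube c ℓ, f z‖ ≤ K := by
  rw [norm_sub_rev, setAverage_cube_sub hf c hℓ]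
  exact (norm_setAverage_le _ _).trans (setAverage_cube_norm_le c hℓ h)

theorem setAverage_norm_sub_eq_mul_osc {ω : ℝ → ℝ} (f : EuclideanSpace ℝ (Fin n) → Y)
    (c : EuclideanSpace ℝ (Fin n)) {ℓ : ℝ} (h : 0 < ω ℓ) :
    (⨍ y in cube c ℓ, ‖f y - ⨍ z in cube c ℓ, f z‖) = ω ℓ * osc ω f c ℓ := by
  rw [osc]
  field_simp

theorem osc_nonneg {ω : ℝ → ℝ} (f : EuclideanSpace ℝ (Fin n) → Y)
    (c : EuclideanSpace ℝ (Fin n)) {ℓ : ℝ} (h : 0 < ω ℓ) : 0 ≤ osc ω f c ℓ :=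
  mul_nonneg (by positivity) (setAverage_norm_nonneg _ _)

/-- Pointwise oscillation controls mean oscillation. -/
theorem osc_le_of_forall_norm_sub_le [CompleteSpace Y] {ω : ℝ → ℝ}
    {f : EuclideanSpace ℝ (Fin n) → Y} (hf : Continuous f) (c : EuclideanSpace ℝ (Fin n))
    {ℓ K : ℝ} (hℓ : 0 < ℓ) (hω : 0 < ω ℓ)
    (h : ∀ x ∈ cube c ℓ, ∀ y ∈ cube c ℓ, ‖f x - f y‖ ≤ K * ω ℓ) : osc ω f c ℓ ≤ K := by
  rw [osc, one_div, inv_mul_le_iff₀ hω, mul_comm]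
  refine setAverage_cube_norm_le c hℓ fun x hx => ?_
  exact norm_sub_setAverage_cube_le hf c hℓ _ fun y hy => h y hy x hx

/-- Averages over a cube and a subcube of half the side differ by the mean oscillation. -/
theorem norm_setAverage_half_cube_sub_le [CompleteSpace Y] {ω : ℝ → ℝ}
    {f : EuclideanSpace ℝ (Fin n) → Y} (hf : Continuous f) {c c' : EuclideanSpace ℝ (Fin n)}
    {ℓ : ℝ} (hℓ : 0 < ℓ) (hω : 0 < ω ℓ) (hsub : cube c' (ℓ / 2) ⊆ cube c ℓ) :
    ‖(⨍ z in cube c ℓ, f z) - ⨍ z in cube c' (ℓ / 2), f z‖ ≤ 2 ^ n * (ω ℓ * osc ω f c ℓ) := by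
  have hℓ2 : 0 < ℓ / 2 := by positivity
  rw [norm_sub_rev, setAverage_cube_sub hf c' hℓ2, ← setAverage_norm_sub_eq_mul_osc f c hω]
  refine (norm_setAverage_le _ _).trans ?_
  generalize (⨍ z in cube c ℓ, f z) = a
  rw [setAverage_eq, setAverage_eq, smul_eq_mul, smul_eq_mul,
    volume_real_cube c' hℓ2.le, volume_real_cube c hℓ.le, div_pow, inv_div, ← mul_assoc,
    ← div_eq_mul_inv]
  gcongr ?_ * ?_
  refine setIntegral_mono_set (integrableOn_cube (by fun_prop) c ℓ) ?_ hsub.eventuallyLE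
  exact Filter.Eventually.of_forall fun x => norm_nonneg _

/-- Homothetic copies of a cube, centred at one of its points `x`. -/
theorem cube_homothety_mono {c x : EuclideanSpace ℝ (Fin n)} {ℓ s t : ℝ} (hx : x ∈ cube c ℓ)
    (hst : s ≤ t) :
    cube (x + s • (c - x)) (s * ℓ) ⊆ cube (x + t • (c - x)) (t * ℓ) := by
  intro y hy i
  have h1 := hx i
  have h2 := hy i
  simp only [PiLp.add_apply, PiLp.smul_apply, PiLp.sub_apply, smul_eq_mul] at h2 ⊢
  constructor <;> nlinarith

theorem mem_cube_homothety {c x : EuclideanSpace ℝ (Fin n)} {ℓ s : ℝ} (hx : x ∈ cube c ℓ)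
    (hs : 0 ≤ s) : x ∈ cube (x + s • (c - x)) (s * ℓ) := by
  intro i
  have h1 := hx i
  simp only [PiLp.add_apply, PiLp.smul_apply, PiLp.sub_apply, smul_eq_mul]
  constructor <;> nlinarith

end CubeAverages

section Modulus

open MeasureTheory

variable {ω : ℝ → ℝ}

theorem modulus_two_pow_mul_le {C : ℝ} (hC : 1 < C) (hdb : ∀ t : ℝ, 0 < t → ω (2 * t) ≤ C * ω t)
    (m : ℕ) {t : ℝ} (ht : 0 < t) : ω (2 ^ m * t) ≤ C ^ m * ω t := by
  induction m with
  | zero => simp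
  | succ m ih =>
    calc ω (2 ^ (m + 1) * t) = ω (2 * (2 ^ m * t)) := by ring_nf
      _ ≤ C * ω (2 ^ m * t) := hdb _ (by positivity)
      _ ≤ C * (C ^ m * ω t) := by gcongr
      _ = C ^ (m + 1) * ω t := by ring

/-- The Dini condition bounds the dyadic sums of a doubling modulus. -/
theorem sum_dyadic_modulus_le {C D : ℝ} (hpos : ∀ t : ℝ, 0 < t → 0 < ω t)
    (hmono : ∀ s t : ℝ, 0 < s → s ≤ t → ω s ≤ ω t) (hC : 1 < C)
    (hdb : ∀ t : ℝ, 0 < t → ω (2 * t) ≤ C * ω t)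
    (hD : ∀ s : ℝ, 0 < s → IntegrableOn (fun t => ω t / t) (Set.Ioc 0 s) ∧
      (∫ t in Set.Ioc (0 : ℝ) s, ω t / t) ≤ D * ω s)
    {ℓ : ℝ} (hℓ : 0 < ℓ) (K : ℕ) :
    ∑ k ∈ Finset.range K, ω (2⁻¹ ^ k * ℓ) ≤ 2 * C * D * ω ℓ := by
  have hint := (hD ℓ hℓ).1
  have key : ∑ k ∈ Finset.range K, ω (2⁻¹ ^ k * ℓ) ≤
      2 * C * ∫ t in Set.Ioc (2⁻¹ ^ K * ℓ) ℓ, ω t / t := by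
    induction K with
    | zero => simp
    | succ K ih =>
      set s : ℝ := 2⁻¹ ^ K * ℓ with hs
      have hs0 : 0 < s := by positivity
      have hsℓ : s ≤ ℓ := mul_le_of_le_one_left hℓ.le (pow_le_one₀ (by norm_num) (by norm_num))
      have hhalf : (2⁻¹ : ℝ) ^ (K + 1) * ℓ = s / 2 := by rw [hs, pow_succ]; ring
      have hi : IntegrableOn (fun t => ω t / t) (Set.Ioc (s / 2) s) :=
        hint.mono_set (Set.Ioc_subset_Ioc (by positivity) hsℓ)
      have hlow : ω (s / 2) / 2 ≤ ∫ t in Set.Ioc (s / 2) s, ω t / t := by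
        have h := setIntegral_mono_on (μ := volume) (f := fun _ => ω (s / 2) / s)
          (integrableOn_const (by simp)) hi measurableSet_Ioc fun t ht => by
            have h0 : 0 < t := (half_pos hs0).trans ht.1
            have h1 := hmono _ _ (half_pos hs0) ht.1.le
            have h2 := hpos _ h0
            have h3 := ht.2
            gcongr
        refine le_trans (le_of_eq ?_) h
        rw [setIntegral_const, Real.volume_real_Ioc_of_le (by linarith), smul_eq_mul]
        field_simp
        ring
      have hd := hdb (s / 2) (half_pos hs0)
      rw [mul_div_cancel₀ s two_ne_zero] at hd
      rw [Finset.sum_range_succ, ← hs, hhalf, ← Set.Ioc_union_Ioc_eq_Ioc (half_le_self hs0.le) hsℓ,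
        setIntegral_union (Set.Ioc_disjoint_Ioc_of_le le_rfl) measurableSet_Ioc hi
          (hint.mono_set (Set.Ioc_subset_Ioc hs0.le le_rfl))]
      have h := mul_le_mul_of_nonneg_left hlow (show 0 ≤ 2 * C by linarith)
      linarith
  refine key.trans ?_
  rw [mul_assoc _ D]
  gcongr
  refine le_trans (setIntegral_mono_set hint ?_ ?_) (hD ℓ hℓ).2
  · filter_upwards [ae_restrict_mem measurableSet_Ioc] with t ht
    exact div_nonneg (hpos t ht.1).le ht.1.le
  · exact (Set.Ioc_subset_Ioc (by positivity) le_rfl).eventuallyLE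

end Modulus

section MeanToPointwise

open MeasureTheory

variable {n : ℕ} {Y : Type*} [NormedAddCommGroup Y] [NormedSpace ℝ Y] [CompleteSpace Y]
  {ω : ℝ → ℝ} {f : EuclideanSpace ℝ (Fin n) → Y} {c x y : EuclideanSpace ℝ (Fin n)} {ℓ ε S : ℝ}

theorem norm_setAverage_sub_setAverage_homothety_le (hpos : ∀ t : ℝ, 0 < t → 0 < ω t)
    (hf : Continuous f) (hℓ : 0 < ℓ) (hx : x ∈ cube c ℓ) (K : ℕ)
    (hosc : ∀ k < K, osc ω f (x + (2⁻¹ : ℝ) ^ k • (c - x)) (2⁻¹ ^ k * ℓ) ≤ ε) :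
    ‖(⨍ z in cube c ℓ, f z) -
        ⨍ z in cube (x + (2⁻¹ : ℝ) ^ K • (c - x)) (2⁻¹ ^ K * ℓ), f z‖ ≤
      2 ^ n * ε * ∑ k ∈ Finset.range K, ω (2⁻¹ ^ k * ℓ) := by
  induction K with
  | zero => simp
  | succ K ih =>
    have hs : (0 : ℝ) < 2⁻¹ ^ K * ℓ := by positivity
    have hhalf : (2⁻¹ : ℝ) ^ (K + 1) * ℓ = 2⁻¹ ^ K * ℓ / 2 := by rw [pow_succ]; ring
    have hsub : cube (x + (2⁻¹ : ℝ) ^ (K + 1) • (c - x)) (2⁻¹ ^ K * ℓ / 2) ⊆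
        cube (x + (2⁻¹ : ℝ) ^ K • (c - x)) (2⁻¹ ^ K * ℓ) := by
      rw [← hhalf]
      exact cube_homothety_mono hx
        (pow_le_pow_of_le_one (by norm_num) (by norm_num) K.le_succ)
    have hstep := norm_setAverage_half_cube_sub_le hf hs (hpos _ hs) hsub
    rw [← hhalf] at hstep
    have h1 := ih fun k hk => hosc k (hk.trans K.lt_succ_self)
    have h2 : ω (2⁻¹ ^ K * ℓ) * osc ω f (x + (2⁻¹ : ℝ) ^ K • (c - x)) (2⁻¹ ^ K * ℓ) ≤
        ω (2⁻¹ ^ K * ℓ) * ε :=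
      mul_le_mul_of_nonneg_left (hosc K K.lt_succ_self) (hpos _ hs).le
    rw [Finset.sum_range_succ, mul_add]
    refine (norm_sub_le_norm_sub_add_norm_sub _ _ _).trans (add_le_add h1 (hstep.trans ?_))
    calc (2 : ℝ) ^ n * (ω (2⁻¹ ^ K * ℓ) * osc ω f _ (2⁻¹ ^ K * ℓ))
        ≤ 2 ^ n * (ω (2⁻¹ ^ K * ℓ) * ε) := by gcongr
      _ = 2 ^ n * ε * ω (2⁻¹ ^ K * ℓ) := by ring

theorem norm_setAverage_cube_sub_le (hpos : ∀ t : ℝ, 0 < t → 0 < ω t)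
    (hS : ∀ ℓ : ℝ, 0 < ℓ → ∀ K : ℕ, ∑ k ∈ Finset.range K, ω (2⁻¹ ^ k * ℓ) ≤ S * ω ℓ)
    (hf : Continuous f) (hℓ : 0 < ℓ) (hε : 0 ≤ ε) (hx : x ∈ cube c ℓ)
    (hosc : ∀ k : ℕ, osc ω f (x + (2⁻¹ : ℝ) ^ k • (c - x)) (2⁻¹ ^ k * ℓ) ≤ ε) :
    ‖(⨍ z in cube c ℓ, f z) - f x‖ ≤ 2 ^ n * ε * (S * ω ℓ) := by
  refine le_of_forall_pos_le_add fun η hη => ?_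
  obtain ⟨ρ, hρ, hball⟩ := Metric.continuous_iff.1 hf x η hη
  have hlim : Filter.Tendsto (fun K : ℕ => n * ((2⁻¹ : ℝ) ^ K * ℓ)) Filter.atTop (nhds 0) := by
    simpa using ((tendsto_pow_atTop_nhds_zero_of_lt_one (r := (2⁻¹ : ℝ)) (by norm_num)
      (by norm_num)).mul_const ℓ).const_mul (n : ℝ)
  obtain ⟨K, hK⟩ := (hlim.eventually_lt_const hρ).exists
  have hs : (0 : ℝ) < 2⁻¹ ^ K * ℓ := by positivity
  have h1 := norm_setAverage_sub_setAverage_homothety_le hpos hf hℓ hx K fun k _ => hosc k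
  have h2 := norm_sub_setAverage_cube_le hf (x + (2⁻¹ : ℝ) ^ K • (c - x)) hs (f x)
    (K := η) fun z hz => by
      rw [← dist_eq_norm]
      refine (hball z ?_).le
      rw [dist_eq_norm]
      exact (norm_sub_le_of_mem_cube hs.le hz (mem_cube_homothety hx (by positivity))).trans_lt hK
  rw [norm_sub_rev] at h2
  refine (norm_sub_le_norm_sub_add_norm_sub _ _ _).trans (add_le_add (h1.trans ?_) h2)
  gcongr
  exact hS ℓ hℓ K

/-- Mean oscillation over all subcubes controls pointwise oscillation. -/
theorem norm_sub_le_of_forall_osc_le (hpos : ∀ t : ℝ, 0 < t → 0 < ω t)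
    (hS : ∀ ℓ : ℝ, 0 < ℓ → ∀ K : ℕ, ∑ k ∈ Finset.range K, ω (2⁻¹ ^ k * ℓ) ≤ S * ω ℓ)
    (hf : Continuous f) (hℓ : 0 < ℓ) (hε : 0 ≤ ε) (hx : x ∈ cube c ℓ) (hy : y ∈ cube c ℓ)
    (hosc : ∀ c' ℓ', 0 < ℓ' → ℓ' ≤ ℓ → cube c' ℓ' ⊆ cube c ℓ → osc ω f c' ℓ' ≤ ε) :
    ‖f x - f y‖ ≤ 2 * (2 ^ n * S) * ε * ω ℓ := by
  have key : ∀ z ∈ cube c ℓ, ‖(⨍ z in cube c ℓ, f z) - f z‖ ≤ 2 ^ n * ε * (S * ω ℓ) := by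
    intro z hz
    refine norm_setAverage_cube_sub_le hpos hS hf hℓ hε hz fun k => ?_
    have hk : (2⁻¹ : ℝ) ^ k ≤ 1 := pow_le_one₀ (by norm_num) (by norm_num)
    refine hosc _ _ (by positivity) (mul_le_of_le_one_left hℓ.le hk) ?_
    simpa using cube_homothety_mono hz hk
  have h1 := key x hx
  have h2 := key y hy
  have h3 := norm_sub_le_norm_sub_add_norm_sub (f x) (⨍ z in cube c ℓ, f z) (f y)
  rw [norm_sub_rev] at h1
  linarith

end MeanToPointwise

section VanishingClasses

open MeasureTheory

variable {n : ℕ} {Y : Type*} [NormedAddCommGroup Y]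
  {ω : ℝ → ℝ} {f : EuclideanSpace ℝ (Fin n) → Y} {C S : ℝ}

theorem HolderFinite.exists_nonneg (hpos : ∀ t : ℝ, 0 < t → 0 < ω t) (h : HolderFinite ω f) :
    ∃ M, 0 ≤ M ∧ HolderLE ω f M := by
  obtain ⟨M, hM⟩ := h
  refine ⟨max M 0, le_max_right _ _, fun x y hxy => (hM x y hxy).trans ?_⟩
  have := hpos _ (norm_pos_iff.2 (sub_ne_zero.2 hxy))
  gcongr
  exact le_max_left _ _

/-- The modulus at the diameter of a cube is controlled by the modulus at its side. -/
theorem modulus_norm_sub_le_of_mem_cube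
    (hmono : ∀ s t : ℝ, 0 < s → s ≤ t → ω s ≤ ω t) (hC : 1 < C)
    (hdb : ∀ t : ℝ, 0 < t → ω (2 * t) ≤ C * ω t) {c x y : EuclideanSpace ℝ (Fin n)} {ℓ : ℝ}
    (hℓ : 0 < ℓ) (hx : x ∈ cube c ℓ) (hy : y ∈ cube c ℓ) (hxy : x ≠ y) :
    ω ‖x - y‖ ≤ C ^ n * ω ℓ := by
  refine (hmono _ _ (norm_pos_iff.2 (sub_ne_zero.2 hxy)) ?_).trans
    (modulus_two_pow_mul_le hC hdb n hℓ)
  refine (norm_sub_le_of_mem_cube hℓ.le hx hy).trans ?_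
  gcongr
  exact_mod_cast n.lt_two_pow_self.le

variable [NormedSpace ℝ Y]

theorem BMOLE.nonneg (hpos : ∀ t : ℝ, 0 < t → 0 < ω t) {M : ℝ} (h : BMOLE ω f M) : 0 ≤ M :=
  (osc_nonneg f 0 (hpos 1 one_pos)).trans (h 0 1 one_pos)

variable [CompleteSpace Y]

theorem osc_le_of_forall_ne (hpos : ∀ t : ℝ, 0 < t → 0 < ω t)
    (hmono : ∀ s t : ℝ, 0 < s → s ≤ t → ω s ≤ ω t) (hC : 1 < C)
    (hdb : ∀ t : ℝ, 0 < t → ω (2 * t) ≤ C * ω t) (hf : Continuous f)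
    (c : EuclideanSpace ℝ (Fin n)) {ℓ K : ℝ} (hℓ : 0 < ℓ) (hK : 0 ≤ K)
    (h : ∀ x ∈ cube c ℓ, ∀ y ∈ cube c ℓ, x ≠ y → ‖f x - f y‖ ≤ K / C ^ n * ω ‖x - y‖) :
    osc ω f c ℓ ≤ K := by
  have hω := hpos ℓ hℓ
  refine osc_le_of_forall_norm_sub_le hf c hℓ hω fun x hx y hy => ?_
  rcases eq_or_ne x y with rfl | hxy
  · rw [sub_self, norm_zero]
    positivity
  · calc ‖f x - f y‖ ≤ K / C ^ n * ω ‖x - y‖ := h x hx y hy hxy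
      _ ≤ K / C ^ n * (C ^ n * ω ℓ) := by
        gcongr
        exact modulus_norm_sub_le_of_mem_cube hmono hC hdb hℓ hx hy hxy
      _ = K * ω ℓ := by field_simp

theorem HolderFinite.exists_bmoLE (hpos : ∀ t : ℝ, 0 < t → 0 < ω t)
    (hmono : ∀ s t : ℝ, 0 < s → s ≤ t → ω s ≤ ω t) (hC : 1 < C)
    (hdb : ∀ t : ℝ, 0 < t → ω (2 * t) ≤ C * ω t) (hf : Continuous f) (h : HolderFinite ω f) :
    ∃ M : ℝ, BMOLE ω f M := by
  obtain ⟨M, hM0, hM⟩ := h.exists_nonneg hpos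
  refine ⟨M * C ^ n, fun c ℓ hℓ => osc_le_of_forall_ne hpos hmono hC hdb hf c hℓ (by positivity)
    fun x _ y _ hxy => ?_⟩
  rw [mul_div_cancel_right₀ _ (by positivity)]
  exact hM x y hxy

theorem BMOLE.holderLE (hpos : ∀ t : ℝ, 0 < t → 0 < ω t)
    (hS : ∀ ℓ : ℝ, 0 < ℓ → ∀ K : ℕ, ∑ k ∈ Finset.range K, ω (2⁻¹ ^ k * ℓ) ≤ S * ω ℓ)
    (hf : Continuous f) {M : ℝ} (h : BMOLE ω f M) : HolderLE ω f (2 * (2 ^ n * S) * M) := by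
  intro x y hxy
  obtain ⟨c, hx, hy⟩ := exists_cube_mem_mem x y
  exact norm_sub_le_of_forall_osc_le hpos hS hf (norm_pos_iff.2 (sub_ne_zero.2 hxy))
    (h.nonneg hpos) hx hy fun c' ℓ' hℓ' _ _ => h c' ℓ' hℓ'

theorem VCsmall.vmoSmall (hpos : ∀ t : ℝ, 0 < t → 0 < ω t)
    (hmono : ∀ s t : ℝ, 0 < s → s ≤ t → ω s ≤ ω t) (hC : 1 < C)
    (hdb : ∀ t : ℝ, 0 < t → ω (2 * t) ≤ C * ω t) (hf : Continuous f) (h : VCsmall ω f) :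
    VMOsmall ω f := by
  refine ⟨h.1.exists_bmoLE hpos hmono hC hdb hf, fun ε hε => ?_⟩
  obtain ⟨δ, hδ, hδf⟩ := h.2 (ε / C ^ n) (by positivity)
  refine ⟨δ / (n + 1), by positivity, fun c ℓ hℓ hℓδ =>
    osc_le_of_forall_ne hpos hmono hC hdb hf c hℓ hε.le fun x hx y hy hxy => hδf x y hxy ?_⟩
  rw [lt_div_iff₀ (by positivity)] at hℓδ
  have := norm_sub_le_of_mem_cube hℓ.le hx hy
  linarith

theorem VCfar.vmoFar (hpos : ∀ t : ℝ, 0 < t → 0 < ω t)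
    (hmono : ∀ s t : ℝ, 0 < s → s ≤ t → ω s ≤ ω t) (hC : 1 < C)
    (hdb : ∀ t : ℝ, 0 < t → ω (2 * t) ≤ C * ω t) (hf : Continuous f) (h : VCfar ω f) :
    VMOfar ω f := by
  refine ⟨h.1.exists_bmoLE hpos hmono hC hdb hf, fun ε hε => ?_⟩
  obtain ⟨δ, hδ, hδf⟩ := h.2 (ε / C ^ n) (by positivity)
  refine ⟨δ, hδ, fun c ℓ hℓ hdist =>
    osc_le_of_forall_ne hpos hmono hC hdb hf c hℓ hε.le fun x hx y hy hxy => ?_⟩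
  have key : ∀ z ∈ cube c ℓ, δ < ‖z‖ := fun z hz =>
    hdist.trans_le (by simpa using Metric.infDist_le_dist_of_mem (x := 0) hz)
  exact hδf x y hxy (key x hx) (key y hy)

theorem VClarge.vmoLarge (hpos : ∀ t : ℝ, 0 < t → 0 < ω t)
    (hmono : ∀ s t : ℝ, 0 < s → s ≤ t → ω s ≤ ω t) (hC : 1 < C)
    (hdb : ∀ t : ℝ, 0 < t → ω (2 * t) ≤ C * ω t)
    (htop : Filter.Tendsto ω Filter.atTop Filter.atTop) (hf : Continuous f) (h : VClarge ω f) : VMOlarge ω f := by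
  obtain ⟨M, hM0, hM⟩ := h.1.exists_nonneg hpos
  refine ⟨h.1.exists_bmoLE hpos hmono hC hdb hf, fun ε hε => ?_⟩
  obtain ⟨δ, hδ, hδf⟩ := h.2 (ε / C ^ n) (by positivity)
  obtain ⟨N, hN⟩ := Filter.eventually_atTop.1 (htop.eventually_ge_atTop (M * ω δ / ε))
  refine ⟨max N 1, by positivity, fun c ℓ hℓ hℓN =>
    osc_le_of_forall_norm_sub_le hf c hℓ (hpos ℓ hℓ) fun x hx y hy => ?_⟩
  have hω := hpos ℓ hℓ
  rcases eq_or_ne x y with rfl | hxy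
  · rw [sub_self, norm_zero]
    positivity
  rcases lt_or_ge δ ‖x - y‖ with hlt | hle
  · calc ‖f x - f y‖ ≤ ε / C ^ n * ω ‖x - y‖ := hδf x y hlt
      _ ≤ ε / C ^ n * (C ^ n * ω ℓ) := by
        gcongr
        exact modulus_norm_sub_le_of_mem_cube hmono hC hdb hℓ hx hy hxy
      _ = ε * ω ℓ := by field_simp
  · have h1 := hN ℓ ((le_max_left _ _).trans hℓN.le)
    rw [div_le_iff₀ hε] at h1
    calc ‖f x - f y‖ ≤ M * ω ‖x - y‖ := hM x y hxy
      _ ≤ M * ω δ := by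
        gcongr
        exact hmono _ _ (norm_pos_iff.2 (sub_ne_zero.2 hxy)) hle
      _ ≤ ε * ω ℓ := by linarith

theorem VMOsmall.vcSmall (hpos : ∀ t : ℝ, 0 < t → 0 < ω t) (hS0 : 0 ≤ S)
    (hS : ∀ ℓ : ℝ, 0 < ℓ → ∀ K : ℕ, ∑ k ∈ Finset.range K, ω (2⁻¹ ^ k * ℓ) ≤ S * ω ℓ)
    (hf : Continuous f) (h : VMOsmall ω f) : VCsmall ω f := by
  obtain ⟨⟨M, hM⟩, h⟩ := h
  refine ⟨⟨_, hM.holderLE hpos hS hf⟩, fun ε hε => ?_⟩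
  obtain ⟨δ, hδ, hδf⟩ := h (ε / (2 * (2 ^ n * S) + 1)) (by positivity)
  refine ⟨δ, hδ, fun x y hxy hlt => ?_⟩
  have hr := norm_pos_iff.2 (sub_ne_zero.2 hxy)
  have hω := hpos _ hr
  obtain ⟨c, hx, hy⟩ := exists_cube_mem_mem x y
  refine (norm_sub_le_of_forall_osc_le hpos hS hf hr (by positivity) hx hy
    fun c' ℓ' hℓ' hle _ => hδf c' ℓ' hℓ' (hle.trans_lt hlt)).trans ?_
  gcongr
  rw [mul_div_assoc', div_le_iff₀ (by positivity)]
  linarith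

theorem VMOlarge.vcLarge (hpos : ∀ t : ℝ, 0 < t → 0 < ω t)
    (hmono : ∀ s t : ℝ, 0 < s → s ≤ t → ω s ≤ ω t) (hS0 : 0 ≤ S)
    (hS : ∀ ℓ : ℝ, 0 < ℓ → ∀ K : ℕ, ∑ k ∈ Finset.range K, ω (2⁻¹ ^ k * ℓ) ≤ S * ω ℓ)
    (htop : Filter.Tendsto ω Filter.atTop Filter.atTop)
    (hf : Continuous f) (h : VMOlarge ω f) : VClarge ω f := by
  obtain ⟨⟨M, hM⟩, h⟩ := h
  have hM0 := hM.nonneg hpos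
  refine ⟨⟨_, hM.holderLE hpos hS hf⟩, fun ε hε => ?_⟩
  set ε' := ε / (4 * (2 ^ n * S) + 1) with hε'
  have hε'0 : 0 < ε' := by positivity
  have hε'ε : 4 * (2 ^ n * S) * ε' ≤ ε := by
    rw [hε', mul_div_assoc', div_le_iff₀ (by positivity)]
    linarith
  obtain ⟨δ, hδ, hδf⟩ := h ε' hε'0
  obtain ⟨N, hN⟩ := Filter.eventually_atTop.1
    (htop.eventually_ge_atTop (4 * (2 ^ n * S) * M * ω (2 * δ) / ε))
  refine ⟨max N δ, by positivity, fun x y hlt => ?_⟩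
  obtain ⟨c, hx, hy⟩ := exists_cube_mem_mem x y
  set r := ‖x - y‖
  have hδr : δ < r := (le_max_right _ _).trans_lt hlt
  have hr : 0 < r := hδ.trans hδr
  have hNr := hN r ((le_max_left _ _).trans hlt.le)
  rw [div_le_iff₀ hε] at hNr
  obtain ⟨K, hK1, hK2⟩ := exists_nat_pow_near ((one_le_div hδ).2 hδr.le) one_lt_two
  rw [le_div_iff₀ hδ] at hK1
  rw [div_lt_iff₀ hδ, pow_succ] at hK2
  have hs : (0 : ℝ) < 2⁻¹ ^ K * r := by positivity
  have hsδ : (2⁻¹ : ℝ) ^ K * r ≤ 2 * δ := by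
    rw [inv_pow, inv_mul_le_iff₀ (by positivity)]
    linarith
  have key : ∀ z ∈ cube c r, ‖(⨍ w in cube c r, f w) - f z‖ ≤
      2 ^ n * ε' * (S * ω r) + 2 ^ n * M * (S * ω (2 * δ)) := by
    intro z hz
    have h1 := norm_setAverage_sub_setAverage_homothety_le hpos hf hr hz K (ε := ε')
      fun k hk => hδf _ _ (by positivity) <| by
        have h2 : (2 : ℝ) ^ (k + 1) ≤ 2 ^ K := pow_le_pow_right₀ one_le_two hk
        rw [inv_pow, lt_inv_mul_iff₀ (by positivity)]
        have h3 : (0 : ℝ) < 2 ^ k * δ := by positivity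
        rw [pow_succ] at h2
        nlinarith
    have h2 := norm_setAverage_cube_sub_le hpos hS hf hs hM0
      (mem_cube_homothety hz (s := (2⁻¹ : ℝ) ^ K) (by positivity))
      fun k => hM _ _ (by positivity)
    refine (norm_sub_le_norm_sub_add_norm_sub _ _ _).trans (add_le_add (h1.trans ?_) (h2.trans ?_))
    · gcongr
      exact hS r hr K
    · gcongr
      exact hmono _ _ hs hsδ
  have h1 := key x hx
  have h2 := key y hy
  have h3 := norm_sub_le_norm_sub_add_norm_sub (f x) (⨍ w in cube c r, f w) (f y)
  rw [norm_sub_rev] at h1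
  have h4 := mul_le_mul_of_nonneg_right hε'ε (hpos r hr).le
  linarith

theorem VMOfar.vcFar (hpos : ∀ t : ℝ, 0 < t → 0 < ω t)
    (hmono : ∀ s t : ℝ, 0 < s → s ≤ t → ω s ≤ ω t) (hC : 1 < C)
    (hdb : ∀ t : ℝ, 0 < t → ω (2 * t) ≤ C * ω t) (hS0 : 0 ≤ S)
    (hS : ∀ ℓ : ℝ, 0 < ℓ → ∀ K : ℕ, ∑ k ∈ Finset.range K, ω (2⁻¹ ^ k * ℓ) ≤ S * ω ℓ)
    (htop : Filter.Tendsto ω Filter.atTop Filter.atTop)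
    (hf : Continuous f) (h : VMOfar ω f) : VCfar ω f := by
  obtain ⟨⟨M, hM⟩, h⟩ := h
  have hfin : HolderFinite ω f := ⟨_, hM.holderLE hpos hS hf⟩
  refine ⟨hfin, fun ε hε => ?_⟩
  rcases isEmpty_or_nonempty (Fin n) with hn | hn
  · exact ⟨1, one_pos, fun x y hxy => absurd (Subsingleton.elim x y) hxy⟩
  obtain ⟨H, hH0, hH⟩ := hfin.exists_nonneg hpos
  have hn1 : (1 : ℝ) ≤ n := by exact_mod_cast Fin.pos_iff_nonempty.2 hn
  set T := 2 * (2 ^ n * S) with hT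
  have hT0 : 0 ≤ T := by positivity
  have hB : 1 ≤ C ^ (n + 2) := one_le_pow₀ hC.le
  set B := C ^ (n + 2)
  set ε' := ε / (4 * T * B + 1) with hε'
  have hε'0 : 0 < ε' := by positivity
  have hε'ε : 4 * (T * ε' * B) ≤ ε := by
    rw [show 4 * (T * ε' * B) = 4 * T * B * ε' by ring, hε', mul_div_assoc',
      div_le_iff₀ (by positivity)]
    linarith
  obtain ⟨δ, hδ, hδf⟩ := h ε' hε'0
  set a := δ + 1 with ha
  have ha0 : 0 < a := by positivity
  have hna : 0 < n * a := by positivity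
  have hpair : ∀ (c : EuclideanSpace ℝ (Fin n)) (ℓ : ℝ), 0 < ℓ → (∀ z ∈ cube c ℓ, a ≤ ‖z‖) →
      ∀ x ∈ cube c ℓ, ∀ y ∈ cube c ℓ, ‖f x - f y‖ ≤ T * ε' * ω ℓ := by
    intro c ℓ hℓ hz x hx y hy
    refine norm_sub_le_of_forall_osc_le hpos hS hf hℓ hε'0.le hx hy fun c' ℓ' hℓ' _ hsub =>
      hδf c' ℓ' hℓ' ?_
    refine (lt_add_one δ).trans_le
      ((Metric.le_infDist ⟨c', mem_cube_self c' hℓ'.le⟩).2 fun z hzc => ?_)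
    rw [dist_zero_left]
    exact hz z (hsub hzc)
  obtain ⟨N, hN⟩ := Filter.eventually_atTop.1
    (htop.eventually_ge_atTop (2 * (H * ω (2 * (n * a))) / ε))
  refine ⟨max (max (2 * a) (n * a)) (2 * n * N), by positivity, fun x y hxy hx hy => ?_⟩
  simp only [max_lt_iff] at hx hy
  obtain ⟨⟨hxa, hxna⟩, hxN⟩ := hx
  obtain ⟨⟨-, hyna⟩, -⟩ := hy
  have hr := norm_pos_iff.2 (sub_ne_zero.2 hxy)
  obtain ⟨c, hxc, hyc⟩ := exists_cube_mem_mem x y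
  have hyx : ‖y‖ ≤ ‖x‖ + ‖x - y‖ := by
    rw [norm_sub_rev]
    exact norm_le_norm_add_norm_sub' y x
  set r := ‖x - y‖ with hr_def
  have hω := hpos r hr
  rcases le_or_gt (2 * (n * r)) ‖x‖ with hle | hgt
  · refine (hpair c r hr (fun z hz => ?_) x hxc y hyc).trans ?_
    · have h1 := norm_sub_le_of_mem_cube hr.le hxc hz
      have h2 := norm_le_norm_add_norm_sub' x z
      linarith
    · gcongr
      have : 0 ≤ T * ε' := by positivity
      nlinarith
  · have hNr : N ≤ r := by
      have : 2 * n * N < 2 * n * r := by linarith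
      exact (lt_of_mul_lt_mul_left this (by positivity)).le
    have hH' := hN r hNr
    rw [div_le_iff₀ hε] at hH'
    have hpow : (n : ℝ) ≤ 2 ^ n := by exact_mod_cast n.lt_two_pow_self.le
    have hscale : ∀ t, 0 < t → t ≤ 4 * (n * r) → ω t ≤ B * ω r := fun t ht htr =>
      (hmono _ _ ht (htr.trans (by rw [pow_add]; nlinarith))).trans
        (modulus_two_pow_mul_le hC hdb (n + 2) hr)
    have hnear : ∀ u : EuclideanSpace ℝ (Fin n), n * a < ‖u‖ → ‖u‖ ≤ 4 * (n * r) →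
        ∃ p : EuclideanSpace ℝ (Fin n), ‖p‖ ≤ n * a ∧ ‖f u - f p‖ ≤ T * ε' * (B * ω r) := by
      intro u hu hur
      obtain ⟨c, p, huc, hpc, hp, hz⟩ := exists_cube_away_from_zero ha0.le hu
      refine ⟨p, hp, (hpair c ‖u‖ (hna.trans hu) hz u huc p hpc).trans ?_⟩
      gcongr
      exact hscale _ (hna.trans hu) hur
    obtain ⟨p, hp, hxp⟩ := hnear x hxna (by linarith [mul_pos (by linarith : (0 : ℝ) < n) hr])
    obtain ⟨q, hq, hyq⟩ := hnear y hyna (by nlinarith)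
    have hpq : ‖f p - f q‖ ≤ H * ω (2 * (n * a)) := by
      rcases eq_or_ne p q with rfl | hne
      · rw [sub_self, norm_zero]
        exact mul_nonneg hH0 (hpos _ (by positivity)).le
      · refine (hH p q hne).trans ?_
        gcongr
        exact hmono _ _ (norm_pos_iff.2 (sub_ne_zero.2 hne))
          ((norm_sub_le p q).trans (by linarith))
    have h1 := norm_sub_le_norm_sub_add_norm_sub (f x) (f p) (f y)
    have h2 := norm_sub_le_norm_sub_add_norm_sub (f p) (f q) (f y)
    rw [norm_sub_rev] at hyq
    have h3 := mul_le_mul_of_nonneg_right hε'ε hω.le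
    linarith

end VanishingClasses

/-- Theorem 1.7 (second part): for a non-decreasing doubling modulus with `[ω]_* < ∞` and
`ω(∞) = ∞`, the pointwise vanishing classes coincide with the mean oscillation vanishing
classes at every scale, for continuous locally Bochner integrable functions. -/
theorem vc_eq_vmo (n : ℕ)
    {Y : Type*} [NormedAddCommGroup Y] [NormedSpace ℝ Y] [CompleteSpace Y]
    (ω : ℝ → ℝ)
    (hpos : ∀ t : ℝ, 0 < t → 0 < ω t)
    (hmono : ∀ s t : ℝ, 0 < s → s ≤ t → ω s ≤ ω t)
    (hdb : ∃ Cdb : ℝ, 1 < Cdb ∧ ∀ t : ℝ, 0 < t → ω (2 * t) ≤ Cdb * ω t)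
    (hdini : ∃ D : ℝ, ∀ s : ℝ, 0 < s →
      MeasureTheory.IntegrableOn (fun t => ω t / t) (Set.Ioc 0 s) ∧
      (∫ t in Set.Ioc (0:ℝ) s, ω t / t) ≤ D * ω s)
    (htop : Filter.Tendsto ω Filter.atTop Filter.atTop)
    (f : EuclideanSpace ℝ (Fin n) → Y) (hf : Continuous f)
    (hloc : MeasureTheory.LocallyIntegrable f) :
    (VCsmall ω f ↔ VMOsmall ω f) ∧
    (VCfar ω f ↔ VMOfar ω f) ∧
    (VClarge ω f ↔ VMOlarge ω f) ∧
    (VCfull ω f ↔ VMOfull ω f) := by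
  obtain ⟨C, hC, hdb⟩ := hdb
  obtain ⟨D, hD⟩ := hdini
  have hS : ∀ ℓ : ℝ, 0 < ℓ → ∀ K : ℕ,
      ∑ k ∈ Finset.range K, ω (2⁻¹ ^ k * ℓ) ≤ 2 * C * D * ω ℓ := fun ℓ hℓ K =>
    sum_dyadic_modulus_le hpos hmono hC hdb hD hℓ K
  have hS0 : 0 ≤ 2 * C * D :=
    nonneg_of_mul_nonneg_left (by simpa using hS 1 one_pos 0) (hpos 1 one_pos)
  have hsmall : VCsmall ω f ↔ VMOsmall ω f :=
    ⟨fun h => h.vmoSmall hpos hmono hC hdb hf, fun h => h.vcSmall hpos hS0 hS hf⟩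
  have hfar : VCfar ω f ↔ VMOfar ω f :=
    ⟨fun h => h.vmoFar hpos hmono hC hdb hf, fun h => h.vcFar hpos hmono hC hdb hS0 hS htop hf⟩
  have hlarge : VClarge ω f ↔ VMOlarge ω f :=
    ⟨fun h => h.vmoLarge hpos hmono hC hdb htop hf,
      fun h => h.vcLarge hpos hmono hS0 hS htop hf⟩
  exact ⟨hsmall, hfar, hlarge, and_congr hsmall (and_congr hlarge hfar)⟩
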